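/- Let 0 < s < 1. On pairs of commuting positive definite n×n complex matrices, the function (L,R) ↦ −L^s R^{1-s} is jointly convex in the Loewner order: if L₁ commutes with R₁, L₂ commutes with R₂, all positive definite, 0 ≤ c ≤ 1, L = cL₁+(1-c)L₂ and R = cR₁+(1-c)R₂ commute, then −L^s R^{1-s} ≤ c·(−L₁^s R₁^{1-s}) + (1-c)·(−L₂^s R₂^{1-s}). -/

import Mathlib

open Matrix
open scoped ComplexOrder

/-- The real power `A ^ s` of a matrix, via the continuous functional calculus. -/
noncomputable def matrixRpow {k : ℕ} (A : Matrix (Fin k) (Fin k) ℂ) (s : ℝ) :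
    Matrix (Fin k) (Fin k) ℂ :=
  cfc (fun x : ℝ => x ^ s) A

open scoped MatrixOrder

section Loewner

lemma Matrix.PosDef.convexComb {n : Type*} {P Q : Matrix n n ℂ} (hP : P.PosDef) (hQ : Q.PosDef) {a b : ℝ}
    (ha : 0 ≤ a) (hb : 0 ≤ b) (hab : a + b = 1) : (a • P + b • Q).PosDef := by
  rcases ha.eq_or_lt with rfl | ha
  · obtain rfl : b = 1 := by linarith
    simpa using hQ
  · exact (hP.smul ha).add_posSemidef (hQ.posSemidef.smul hb)

variable {n : Type*} [Fintype n] [DecidableEq n]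

open scoped Matrix.Norms.L2Operator in
/-- A self-adjoint matrix is dominated by a positive one as soon as its square is. -/
lemma Matrix.le_of_mul_self_le_mul_self {Y Z : Matrix n n ℂ} (hY : IsSelfAdjoint Y)
    (hZ : 0 ≤ Z) (h : Y * Y ≤ Z * Z) : Y ≤ Z := by
  have habs : Y ≤ CFC.abs Y := by
    rw [← sub_nonneg, CFC.abs_sub_self Y hY]
    exact nsmul_nonneg (CFC.negPart_nonneg Y) 2
  have hsqrt : CFC.abs Y ≤ Z := by
    rw [CFC.abs, hY.star_eq, ← CFC.sqrt_mul_self Z hZ]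
    exact CFC.sqrt_le_sqrt _ _ h
  exact habs.trans hsqrt

/-- Comparison of Hermitian matrices through their quadratic Riccati expressions. -/
lemma Matrix.PosDef.le_of_mul_inv_mul_le {A C X : Matrix n n ℂ} (hA : A.PosDef)
    (hC : C.PosSemidef) (hX : X.IsHermitian) (h : X * A⁻¹ * X ≤ C * A⁻¹ * C) : X ≤ C := by
  set S := CFC.sqrt A⁻¹
  have hS0 : 0 ≤ S := CFC.sqrt_nonneg _
  have hSS : S * S = A⁻¹ := CFC.sqrt_mul_sqrt_self _ hA.inv.posSemidef.nonneg
  have hSu : IsUnit S := isUnit_of_mul_isUnit_left (hSS ▸ hA.inv.isUnit)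
  have hSa : IsSelfAdjoint S := .of_nonneg hS0
  have conj_sq (T : Matrix n n ℂ) : S * T * S * (S * T * S) = S * (T * A⁻¹ * T) * S := by
    simp only [← hSS, mul_assoc]
  have key : S * X * S ≤ S * C * S := by
    refine Matrix.le_of_mul_self_le_mul_self ?_ ?_ ?_
    · simpa [hSa.star_eq] using IsSelfAdjoint.conjugate (x := X) hX S
    · simpa [hSa.star_eq] using star_left_conjugate_nonneg hC.nonneg S
    · rw [conj_sq, conj_sq]
      simpa [hSa.star_eq] using star_left_conjugate_le_conjugate h S
  rw [Matrix.le_iff] at key ⊢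
  rw [← Matrix.IsUnit.posSemidef_star_left_conjugate_iff hSu]
  simpa [hSa.star_eq, mul_sub, sub_mul] using key

/-- Joint concavity of the matrix geometric mean `C = A # B`, characterised by the Riccati
equation `C A⁻¹ C = B`, combined with its monotonicity in both arguments. -/
lemma Matrix.convexComb_le_of_riccati {A B C A₁ B₁ C₁ A₂ B₂ C₂ : Matrix n n ℂ}
    (hA : A.PosDef) (hC : C.PosDef)
    (hA₁ : A₁.PosDef) (hB₁ : B₁.PosDef) (hC₁ : C₁.PosDef)
    (hA₂ : A₂.PosDef) (hB₂ : B₂.PosDef) (hC₂ : C₂.PosDef)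
    (h : C * A⁻¹ * C = B) (h₁ : C₁ * A₁⁻¹ * C₁ = B₁) (h₂ : C₂ * A₂⁻¹ * C₂ = B₂)
    {a b : ℝ} (ha : 0 ≤ a) (hb : 0 ≤ b) (hab : a + b = 1)
    (hAle : a • A₁ + b • A₂ ≤ A) (hBle : a • B₁ + b • B₂ ≤ B) :
    a • C₁ + b • C₂ ≤ C := by
  have block {P Q T : Matrix n n ℂ} (hP : P.PosDef) (hT : T.PosDef) (hPQ : T * P⁻¹ * T = Q) :
      (fromBlocks P T Tᴴ Q).PosSemidef := by
    have := hP.isUnit.invertible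
    rw [PosDef.fromBlocks₁₁ _ _ hP, hT.1.eq, hPQ, sub_self]
    exact .zero
  set X := a • C₁ + b • C₂ with hXdef
  have hX : X.IsHermitian := (hC₁.convexComb hC₂ ha hb hab).1
  have hB' := hB₁.convexComb hB₂ ha hb hab
  have hblock : (fromBlocks (a • A₁ + b • A₂) X Xᴴ (a • B₁ + b • B₂)).PosSemidef := by
    have := ((block hA₁ hC₁ h₁).smul ha).add ((block hA₂ hC₂ h₂).smul hb)
    rw [hX.eq]
    rwa [fromBlocks_smul, fromBlocks_smul, fromBlocks_add, hC₁.1.eq, hC₂.1.eq, ← hXdef] at this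
  have hBi := hB'.isUnit.invertible
  have hAi := hA.isUnit.invertible
  rw [PosDef.fromBlocks₂₂ _ _ hB'] at hblock
  have hblock' : (A - X * (a • B₁ + b • B₂)⁻¹ * Xᴴ).PosSemidef := by
    simpa using hblock.add (Matrix.le_iff.mp hAle)
  rw [← PosDef.fromBlocks₂₂ _ _ hB', PosDef.fromBlocks₁₁ _ _ hA, hX.eq] at hblock'
  refine hA.le_of_mul_inv_mul_le hC.posSemidef hX ?_
  rw [h]
  exact (Matrix.le_iff.mpr hblock').trans hBle

end Loewner

section Rpow

variable {k : ℕ} {A B : Matrix (Fin k) (Fin k) ℂ}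

lemma Matrix.PosDef.continuous_matrixRpow (hA : A.PosDef) : Continuous (matrixRpow A) := by
  have hpow (i : Fin k) : Continuous fun s : ℝ => hA.1.eigenvalues i ^ s :=
    Real.continuous_const_rpow (hA.eigenvalues_pos i).ne'
  have : matrixRpow A = fun s => (hA.1.eigenvectorUnitary : Matrix (Fin k) (Fin k) ℂ) *
      diagonal (fun i => ((hA.1.eigenvalues i ^ s : ℝ) : ℂ)) *
      star (hA.1.eigenvectorUnitary : Matrix (Fin k) (Fin k) ℂ) := by
    ext1 s
    rw [matrixRpow, hA.1.cfc_eq, IsHermitian.cfc, Unitary.conjStarAlgAut_apply]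
    rfl
  rw [this]
  have hd : Continuous fun s : ℝ =>
      diagonal (fun i => ((hA.1.eigenvalues i ^ s : ℝ) : ℂ)) :=
    Continuous.matrix_diagonal (continuous_pi fun i => Complex.continuous_ofReal.comp (hpow i))
  exact (continuous_const.matrix_mul hd).matrix_mul continuous_const

lemma Matrix.PosDef.pos_of_mem_spectrum (hA : A.PosDef) {x : ℝ} (hx : x ∈ spectrum ℝ A) :
    0 < x := by
  rw [hA.1.spectrum_real_eq_range_eigenvalues] at hx
  obtain ⟨i, rfl⟩ := hx
  exact hA.eigenvalues_pos i

lemma Matrix.PosDef.matrixRpow_add (hA : A.PosDef) (s t : ℝ) :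
    matrixRpow A (s + t) = matrixRpow A s * matrixRpow A t := by
  have hcont (r : ℝ) : ContinuousOn (fun x : ℝ => x ^ r) (spectrum ℝ A) := fun x hx =>
    (Real.continuousAt_rpow_const x r (.inl (hA.pos_of_mem_spectrum hx).ne')).continuousWithinAt
  rw [matrixRpow, matrixRpow, matrixRpow, ← cfc_mul _ _ A (hcont s) (hcont t)]
  exact cfc_congr fun x hx => Real.rpow_add (hA.pos_of_mem_spectrum hx) s t

lemma Matrix.PosDef.matrixRpow_zero (hA : A.PosDef) : matrixRpow A 0 = 1 := by
  simp only [matrixRpow, Real.rpow_zero]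
  exact cfc_const_one ℝ A hA.1

lemma Matrix.PosDef.matrixRpow_one (hA : A.PosDef) : matrixRpow A 1 = A := by
  simp only [matrixRpow, Real.rpow_one]
  exact cfc_id' ℝ A hA.1

lemma Matrix.PosDef.isUnit_matrixRpow (hA : A.PosDef) (s : ℝ) : IsUnit (matrixRpow A s) :=
  .of_mul_eq_one (matrixRpow A (-s)) (by
    rw [← hA.matrixRpow_add, add_neg_cancel, hA.matrixRpow_zero])

lemma isSelfAdjoint_matrixRpow (A : Matrix (Fin k) (Fin k) ℂ) (s : ℝ) :
    IsSelfAdjoint (matrixRpow A s) :=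
  cfc_predicate _ A

lemma Commute.matrixRpow (h : Commute A B) (s t : ℝ) :
    Commute (matrixRpow A s) (matrixRpow B t) :=
  ((h.cfc_real _).symm.cfc_real _).symm

/-- The product `Lˢ R¹⁻ˢ`. -/
noncomputable def rpowMulRpow (L R : Matrix (Fin k) (Fin k) ℂ) (s : ℝ) :
    Matrix (Fin k) (Fin k) ℂ :=
  matrixRpow L s * matrixRpow R (1 - s)

lemma matrixRpow_mul_mul_matrixRpow_mul (hA : A.PosDef) (hB : B.PosDef) (h : Commute A B)
    (s t u v : ℝ) :
    matrixRpow A s * matrixRpow B t * (matrixRpow A u * matrixRpow B v) =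
      matrixRpow A (s + u) * matrixRpow B (t + v) := by
  rw [hA.matrixRpow_add, hB.matrixRpow_add, (h.matrixRpow u t).symm.mul_mul_mul_comm]

lemma posDef_rpowMulRpow (hA : A.PosDef) (hB : B.PosDef) (h : Commute A B) (s : ℝ) :
    (rpowMulRpow A B s).PosDef := by
  set G := matrixRpow A (s / 2) * matrixRpow B ((1 - s) / 2) with hG
  have hGu : IsUnit G := (hA.isUnit_matrixRpow _).mul (hB.isUnit_matrixRpow _)
  have hGa : IsSelfAdjoint G :=
    ((isSelfAdjoint_matrixRpow A _).commute_iff (isSelfAdjoint_matrixRpow B _)).mp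
      (h.matrixRpow _ _)
  have hGG : G * G = rpowMulRpow A B s := by
    rw [hG, matrixRpow_mul_mul_matrixRpow_mul hA hB h, add_halves, add_halves, rpowMulRpow]
  have := (Matrix.IsUnit.posDef_star_left_conjugate_iff hGu).mpr
    (PosDef.one (n := Fin k) (R := ℂ))
  rwa [mul_one, hGa.star_eq, hGG] at this

lemma rpowMulRpow_midpoint_riccati (hA : A.PosDef) (hB : B.PosDef) (h : Commute A B) (s t : ℝ) :
    rpowMulRpow A B ((s + t) / 2) * (rpowMulRpow A B s)⁻¹ * rpowMulRpow A B ((s + t) / 2) =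
      rpowMulRpow A B t := by
  have hdet := (Matrix.isUnit_iff_isUnit_det _).mp (posDef_rpowMulRpow hA hB h s).isUnit
  have hcomm : rpowMulRpow A B ((s + t) / 2) * rpowMulRpow A B ((s + t) / 2) =
      rpowMulRpow A B s * rpowMulRpow A B t := by
    simp only [rpowMulRpow, matrixRpow_mul_mul_matrixRpow_mul hA hB h]
    congr 2 <;> ring
  have hswap : Commute (rpowMulRpow A B ((s + t) / 2)) (rpowMulRpow A B s) := by
    simp only [Commute, SemiconjBy, rpowMulRpow, matrixRpow_mul_mul_matrixRpow_mul hA hB h]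
    congr 2 <;> ring
  have hswap' : rpowMulRpow A B ((s + t) / 2) * (rpowMulRpow A B s)⁻¹ =
      (rpowMulRpow A B s)⁻¹ * rpowMulRpow A B ((s + t) / 2) := by
    rw [← Matrix.mul_nonsing_inv_cancel_right _ ((rpowMulRpow A B s)⁻¹ * _) hdet,
      mul_assoc _ _ (rpowMulRpow A B s), hswap.eq,
      Matrix.nonsing_inv_mul_cancel_left _ _ hdet]
  rw [hswap', mul_assoc, hcomm, Matrix.nonsing_inv_mul_cancel_left _ _ hdet]

end Rpow

/-- A closed midpoint-convex set of reals contains every point between two of its elements. -/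
lemma Icc_subset_of_isClosed_of_midpoint {S : Set ℝ} (hS : IsClosed S)
    (hmid : ∀ x ∈ S, ∀ y ∈ S, (x + y) / 2 ∈ S) {x y : ℝ} (hx : x ∈ S) (hy : y ∈ S) :
    Set.Icc x y ⊆ S := by
  rintro t ⟨hxt, hty⟩
  have hbddA : BddAbove (S ∩ Set.Iic t) := ⟨t, fun _ h => h.2⟩
  have hbddB : BddBelow (S ∩ Set.Ici t) := ⟨t, fun _ h => h.2⟩
  obtain ⟨haS, hat⟩ := (hS.inter isClosed_Iic).csSup_mem ⟨x, hx, hxt⟩ hbddA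
  obtain ⟨hbS, htb⟩ := (hS.inter isClosed_Ici).csInf_mem ⟨y, hy, hty⟩ hbddB
  set a := sSup (S ∩ Set.Iic t)
  set b := sInf (S ∩ Set.Ici t)
  rw [Set.mem_Iic] at hat
  rw [Set.mem_Ici] at htb
  have hm := hmid a haS b hbS
  rcases le_total ((a + b) / 2) t with h | h
  · have : (a + b) / 2 ≤ a := le_csSup hbddA ⟨hm, h⟩
    rwa [le_antisymm (by linarith : t ≤ a) hat]
  · have : b ≤ (a + b) / 2 := csInf_le hbddB ⟨hm, h⟩
    rwa [le_antisymm htb (by linarith : b ≤ t)]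

lemma Matrix.isClosed_setOf_posSemidef {n : Type*} [Fintype n] :
    IsClosed {M : Matrix n n ℂ | M.PosSemidef} := by
  simp only [Matrix.posSemidef_iff_dotProduct_mulVec, Matrix.IsHermitian, Set.ofPred_and,
    Set.ofPred_forall]
  refine (isClosed_eq (by fun_prop) continuous_id).inter (isClosed_iInter fun x => ?_)
  exact isClosed_le continuous_const (by fun_prop)

/-- For `0 < s < 1`, the map `(L,R) ↦ −Lˢ R¹⁻ˢ` is jointly convex, in the Loewner order,
on commuting pairs of positive definite matrices. -/
theorem neg_rpow_mul_rpow_jointly_convex {k : ℕ} (s : ℝ) (hs0 : 0 < s) (hs1 : s < 1)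
    (L₁ R₁ L₂ R₂ L R : Matrix (Fin k) (Fin k) ℂ)
    (hL₁ : L₁.PosDef) (hR₁ : R₁.PosDef) (hL₂ : L₂.PosDef) (hR₂ : R₂.PosDef)
    (hc₁ : Commute L₁ R₁) (hc₂ : Commute L₂ R₂)
    (c : ℝ) (hc0 : 0 ≤ c) (hc1 : c ≤ 1)
    (hL : L = c • L₁ + (1 - c) • L₂) (hR : R = c • R₁ + (1 - c) • R₂)
    (hcLR : Commute L R) :
    (c • (-(matrixRpow L₁ s * matrixRpow R₁ (1 - s)))
      + (1 - c) • (-(matrixRpow L₂ s * matrixRpow R₂ (1 - s)))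
      - (-(matrixRpow L s * matrixRpow R (1 - s)))).PosSemidef := by
  have hd0 : 0 ≤ 1 - c := sub_nonneg.mpr hc1
  have hLp : L.PosDef := hL ▸ hL₁.convexComb hL₂ hc0 hd0 (add_sub_cancel c 1)
  have hRp : R.PosDef := hR ▸ hR₁.convexComb hR₂ hc0 hd0 (add_sub_cancel c 1)
  let S : Set ℝ := {r | c • rpowMulRpow L₁ R₁ r + (1 - c) • rpowMulRpow L₂ R₂ r
    ≤ rpowMulRpow L R r}
  have hcont {P Q : Matrix (Fin k) (Fin k) ℂ} (hP : P.PosDef) (hQ : Q.PosDef) :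
      Continuous (rpowMulRpow P Q) :=
    hP.continuous_matrixRpow.matrix_mul
      (hQ.continuous_matrixRpow.comp (continuous_const.sub continuous_id))
  have hclosed : IsClosed S :=
    Matrix.isClosed_setOf_posSemidef.preimage ((hcont hLp hRp).sub
      (((hcont hL₁ hR₁).const_smul c).add ((hcont hL₂ hR₂).const_smul (1 - c))))
  have hmid : ∀ x ∈ S, ∀ y ∈ S, (x + y) / 2 ∈ S := fun x hx y hy =>
    Matrix.convexComb_le_of_riccati
      (posDef_rpowMulRpow hLp hRp hcLR _) (posDef_rpowMulRpow hLp hRp hcLR _)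
      (posDef_rpowMulRpow hL₁ hR₁ hc₁ _) (posDef_rpowMulRpow hL₁ hR₁ hc₁ _)
      (posDef_rpowMulRpow hL₁ hR₁ hc₁ _)
      (posDef_rpowMulRpow hL₂ hR₂ hc₂ _) (posDef_rpowMulRpow hL₂ hR₂ hc₂ _)
      (posDef_rpowMulRpow hL₂ hR₂ hc₂ _)
      (rpowMulRpow_midpoint_riccati hLp hRp hcLR x y)
      (rpowMulRpow_midpoint_riccati hL₁ hR₁ hc₁ x y)
      (rpowMulRpow_midpoint_riccati hL₂ hR₂ hc₂ x y)
      hc0 hd0 (add_sub_cancel c 1) hx hy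
  have hzero : (0 : ℝ) ∈ S := by
    simp [S, rpowMulRpow, PosDef.matrixRpow_zero, PosDef.matrixRpow_one, hL₁, hR₁, hL₂, hR₂,
      hLp, hRp, ← hR]
  have hone : (1 : ℝ) ∈ S := by
    simp [S, rpowMulRpow, PosDef.matrixRpow_zero, PosDef.matrixRpow_one, hL₁, hR₁, hL₂, hR₂,
      hLp, hRp, ← hL]
  have hs : s ∈ S := Icc_subset_of_isClosed_of_midpoint hclosed hmid hzero hone ⟨hs0.le, hs1.le⟩
  have hpsd := Matrix.le_iff.mp hs
  simp only [rpowMulRpow] at hpsd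
  refine Eq.mp (congrArg Matrix.PosSemidef ?_) hpsd
  simp only [smul_neg]
  abel
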